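/- Let k ≥ 3 and ℓ ∈ [k−1], and set t = ⌊k/(k−ℓ)⌋·(k−ℓ). There exists μ₀ > 0 such that for every μ ∈ (0, μ₀] there exists μ'₀ > 0 such that for every μ' ∈ (0, μ'₀] there exists ε₀ > 0 such that for every ε ∈ (0, ε₀] there exists γ₀ > 0 such that the following holds for every γ ∈ [0, γ₀] and all integers m, s ≥ 1. Let F be an s-vertex k-graph with no isolated vertices and δ*(F) ≥ (1 − 1/t − ε)·s, such that every set of at least s/t vertices contains at least μs² supported pairs, and let F* be a (γ,m)-regular blow-up of F with N = |V(F*)|. Then F* has no isolated vertices, δ*(F*) ≥ (1 − 1/t − 2ε)·N, and every set of at least N/t vertices of F* contains at least μ'N² supported pairs. -/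

import Mathlib

open Finset

/-- The number of supported pairs (supported 2-sets) contained in `A`. -/
def suppPairs {N : ℕ} (E : Finset (Finset (Fin N))) (A : Finset (Fin N)) : ℕ :=
  ((A.powersetCard 2).filter fun p => ∃ e ∈ E, p ⊆ e).card

/-- The edge set of the blow-up of the hypergraph with edge set `S`, where the
vertex `v` is blown up into the part `B v`. -/
def blowUpEdges {s N : ℕ} (S : Finset (Finset (Fin s))) (B : Fin s → Finset (Fin N)) :
    Finset (Finset (Fin N)) :=
  Finset.univ.filter fun e => ∃ f ∈ S, e ⊆ f.biUnion B ∧ ∀ v ∈ f, (e ∩ B v).card = 1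

section BlowUp

variable {s N : ℕ} {F : Finset (Finset (Fin s))} {B : Fin s → Finset (Fin N)}
  {p : Fin N → Fin s}

/-- A set is an edge of the blow-up iff its projection is injective with image an edge. -/
theorem mem_blowUpEdges_iff (hp : ∀ w v, w ∈ B v ↔ p w = v) (e : Finset (Fin N)) :
    e ∈ blowUpEdges F B ↔ e.image p ∈ F ∧ Set.InjOn p e := by
  simp only [blowUpEdges, mem_filter, mem_univ, true_and]
  constructor
  · rintro ⟨f, hf, hsub, hcard⟩
    have hmem : ∀ x ∈ e, p x ∈ f := by
      intro x hx
      obtain ⟨v, hv, hxv⟩ := mem_biUnion.1 (hsub hx)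
      rwa [(hp x v).1 hxv]
    have himage : e.image p = f := by
      ext v
      constructor
      · rw [mem_image]
        rintro ⟨x, hx, rfl⟩
        exact hmem x hx
      · intro hv
        obtain ⟨x, hx⟩ := card_eq_one.1 (hcard v hv)
        have hx' : x ∈ e ∩ B v := by simp [hx]
        exact mem_image.2 ⟨x, (mem_inter.1 hx').1, (hp x v).1 (mem_inter.1 hx').2⟩
    refine ⟨himage ▸ hf, ?_⟩
    intro x hx y hy hxy
    exact card_le_one.1 (hcard (p x) (hmem x hx)).le x
      (mem_inter.2 ⟨hx, (hp _ _).2 rfl⟩) y (mem_inter.2 ⟨hy, (hp _ _).2 hxy.symm⟩)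
  · rintro ⟨hF, hinj⟩
    refine ⟨_, hF, fun x hx => mem_biUnion.2 ⟨p x, mem_image_of_mem p hx, (hp _ _).2 rfl⟩, ?_⟩
    intro v hv
    obtain ⟨x, hx, rfl⟩ := mem_image.1 hv
    refine card_eq_one.2 ⟨x, ?_⟩
    ext y
    simp only [mem_inter, hp, mem_singleton]
    exact ⟨fun h => hinj h.1 hx h.2, fun h => by subst h; exact ⟨hx, rfl⟩⟩

/-- A partial transversal projecting into an edge extends to an edge of the blow-up. -/
theorem exists_mem_blowUpEdges_superset (hp : ∀ w v, w ∈ B v ↔ p w = v)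
    (hsurj : Function.Surjective p) {T : Finset (Fin N)} (hT : Set.InjOn p T)
    {f : Finset (Fin s)} (hf : f ∈ F) (hTf : T.image p ⊆ f) :
    ∃ e ∈ blowUpEdges F B, T ⊆ e := by
  have hrep : ∀ v, ∃ x, p x = v ∧ (v ∈ T.image p → x ∈ T) := by
    intro v
    by_cases hv : v ∈ T.image p
    · obtain ⟨x, hx, hxv⟩ := mem_image.1 hv
      exact ⟨x, hxv, fun _ => hx⟩
    · obtain ⟨x, hx⟩ := hsurj v
      exact ⟨x, hx, fun h => absurd h hv⟩
  choose r hr hrT using hrep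
  refine ⟨f.image r, (mem_blowUpEdges_iff hp _).2 ⟨?_, ?_⟩, ?_⟩
  · have : (f.image r).image p = f := by
      rw [image_image, show p ∘ r = id from funext hr, image_id]
    rwa [this]
  · intro x hx y hy hxy
    obtain ⟨u, -, rfl⟩ := mem_image.1 (mem_coe.1 hx)
    obtain ⟨v, -, rfl⟩ := mem_image.1 (mem_coe.1 hy)
    rw [hr, hr] at hxy
    rw [hxy]
  · intro x hx
    have hpx := mem_image_of_mem p hx
    exact mem_image.2 ⟨p x, hTf hpx, hT (hrT _ hpx) hx (hr _)⟩

/-- If all parts have at least `L` elements, the degree of a transversal set in the blow-up is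
at least `L` times the degree of its projection. -/
theorem mul_degree_image_le_degree_blowUpEdges (hp : ∀ w v, w ∈ B v ↔ p w = v) {k : ℕ}
    (hk : ∀ e ∈ F, e.card = k) {L : ℝ} (hL : ∀ v, L ≤ (B v).card)
    {S : Finset (Fin N)} (hS : Set.InjOn p S) (hSk : S.card + 1 = k) :
    ((F.filter fun e => S.image p ⊆ e).card : ℝ) * L ≤
      ((blowUpEdges F B).filter fun e => S ⊆ e).card := by
  set V : Finset (Fin s) := univ.filter fun v => v ∉ S.image p ∧ insert v (S.image p) ∈ F with hV
  have hmono : F.filter (fun e => S.image p ⊆ e) ⊆ V.image fun v => insert v (S.image p) := by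
    intro f hf
    obtain ⟨hfF, hSf⟩ := mem_filter.1 hf
    obtain ⟨v, hv, hvf⟩ := exists_eq_insert_iff.2
      ⟨hSf, by rw [card_image_of_injOn hS, hSk, hk f hfF]⟩
    exact mem_image.2 ⟨v, by simp only [hV, mem_filter, mem_univ, true_and]; exact ⟨hv, hvf ▸ hfF⟩,
      hvf⟩
  obtain hL0 | hL0 := le_total L 0
  · exact (mul_nonpos_of_nonneg_of_nonpos (Nat.cast_nonneg _) hL0).trans (Nat.cast_nonneg _)
  have hdisj : (V : Set (Fin s)).PairwiseDisjoint B := by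
    intro u _ v _ huv
    refine disjoint_left.2 fun x hxu hxv => huv ?_
    rw [← (hp x u).1 hxu, (hp x v).1 hxv]
  have hnot : ∀ x ∈ V.biUnion B, x ∉ S := by
    intro x hx hxS
    obtain ⟨v, hv, hxv⟩ := mem_biUnion.1 hx
    rw [← (hp x v).1 hxv] at hv
    exact (mem_filter.1 hv).2.1 (mem_image_of_mem p hxS)
  have hle : (V.biUnion B).card ≤ ((blowUpEdges F B).filter fun e => S ⊆ e).card := by
    refine card_le_card_of_injOn (fun x => insert x S) ?_ ?_
    · intro x hx
      obtain ⟨v, hv, hxv⟩ := mem_biUnion.1 (mem_coe.1 hx)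
      have hv' := (mem_filter.1 hv).2
      rw [← (hp x v).1 hxv] at hv'
      refine mem_coe.2 (mem_filter.2 ⟨(mem_blowUpEdges_iff hp _).2 ⟨?_, ?_⟩, subset_insert _ _⟩)
      · rw [image_insert]
        exact hv'.2
      · rw [coe_insert, Set.injOn_insert (by exact_mod_cast hnot x hx)]
        exact ⟨hS, by exact_mod_cast hv'.1⟩
    · intro x hx y _ hxy
      have hmem : x ∈ insert y S := by
        rw [← show insert x S = insert y S from hxy]
        exact mem_insert_self x S
      exact (mem_insert.1 hmem).resolve_right (hnot x hx)
  calc ((F.filter fun e => S.image p ⊆ e).card : ℝ) * L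
      ≤ (V.card : ℝ) * L := by
        gcongr
        exact (card_le_card hmono).trans card_image_le
    _ = ∑ _v ∈ V, L := by simp
    _ ≤ ∑ v ∈ V, ((B v).card : ℝ) := sum_le_sum fun v _ => hL v
    _ = ((V.biUnion B).card : ℝ) := by rw [card_biUnion hdisj]; push_cast; rfl
    _ ≤ _ := by exact_mod_cast hle

/-- If `A` meets every part indexed by `U` in at least `L` elements, every supported pair in `U`
gives at least `L ^ 2` supported pairs of the blow-up in `A`. -/
theorem suppPairs_mul_sq_le_suppPairs_blowUpEdges (hp : ∀ w v, w ∈ B v ↔ p w = v)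
    (hsurj : Function.Surjective p) {A : Finset (Fin N)} {U : Finset (Fin s)} {L : ℝ}
    (hL0 : 0 ≤ L) (hL : ∀ v ∈ U, L ≤ (A ∩ B v).card) :
    (suppPairs F U : ℝ) * L ^ 2 ≤ suppPairs (blowUpEdges F B) A := by
  unfold suppPairs
  set P := (U.powersetCard 2).filter fun q => ∃ e ∈ F, q ⊆ e with hP
  set Q := (A.powersetCard 2).filter fun q => ∃ e ∈ blowUpEdges F B, q ⊆ e with hQ
  have hfib : ∀ q ∈ P, L ^ 2 ≤ ((Q.filter fun z => z.image p = q).card : ℝ) := by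
    intro q hq
    obtain ⟨hqU, f, hf, hqf⟩ := mem_filter.1 hq
    obtain ⟨hqU, hq2⟩ := mem_powersetCard.1 hqU
    obtain ⟨u, v, huv, rfl⟩ := card_eq_two.1 hq2
    have hle : ((A ∩ B u) ×ˢ (A ∩ B v)).card ≤ (Q.filter fun z => z.image p = {u, v}).card := by
      refine card_le_card_of_injOn (fun x => {x.1, x.2}) ?_ ?_
      · rintro ⟨x, y⟩ hxy
        simp only [coe_product, Set.mem_prod, mem_coe, mem_inter, hp] at hxy
        obtain ⟨⟨hxA, rfl⟩, hyA, rfl⟩ := hxy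
        have hne : x ≠ y := fun h => huv (h ▸ rfl)
        have himage : ({x, y} : Finset (Fin N)).image p = {p x, p y} := by
          rw [image_insert, image_singleton]
        refine mem_coe.2 (mem_filter.2 ⟨mem_filter.2 ⟨mem_powersetCard.2 ⟨?_, card_pair hne⟩, ?_⟩,
          himage⟩)
        · intro z hz
          rcases mem_insert.1 hz with rfl | hz
          · exact hxA
          · rwa [mem_singleton.1 hz]
        · refine exists_mem_blowUpEdges_superset hp hsurj ?_ hf (himage ▸ hqf)
          rw [coe_pair, Set.injOn_pair]
          exact fun h => absurd h huv
      · rintro ⟨x, y⟩ hxy ⟨x', y'⟩ hxy' h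
        simp only [coe_product, Set.mem_prod, mem_coe, mem_inter, hp] at hxy hxy'
        obtain ⟨⟨-, hx⟩, -, hy⟩ := hxy
        obtain ⟨⟨-, hx'⟩, -, hy'⟩ := hxy'
        have hpair : ({x, y} : Finset (Fin N)) = {x', y'} := h
        have hxmem : x = x' ∨ x = y' := by
          simpa [hpair] using (mem_insert_self x {y} : x ∈ ({x, y} : Finset (Fin N)))
        have hymem : y = x' ∨ y = y' := by
          simpa [hpair] using
            (mem_insert_of_mem (mem_singleton_self y) : y ∈ ({x, y} : Finset (Fin N)))
        refine Prod.ext (hxmem.resolve_right ?_) (hymem.resolve_left ?_)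
        · rintro rfl
          exact huv (hx.symm.trans hy')
        · rintro rfl
          exact huv (hx'.symm.trans hy)
    rw [card_product] at hle
    calc L ^ 2 = L * L := sq L
      _ ≤ ((A ∩ B u).card : ℝ) * (A ∩ B v).card :=
        mul_le_mul (hL u (hqU (by simp))) (hL v (hqU (by simp))) hL0 (Nat.cast_nonneg _)
      _ ≤ _ := by exact_mod_cast hle
  have hdisj : (P : Set (Finset (Fin s))).PairwiseDisjoint
      fun q => Q.filter fun z => z.image p = q := by
    intro q _ q' _ hne
    exact disjoint_left.2 fun z hz hz' =>
      hne ((mem_filter.1 hz).2.symm.trans (mem_filter.1 hz').2)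
  calc (P.card : ℝ) * L ^ 2 = ∑ _q ∈ P, L ^ 2 := by simp
    _ ≤ ∑ q ∈ P, ((Q.filter fun z => z.image p = q).card : ℝ) := sum_le_sum hfib
    _ = ((P.biUnion fun q => Q.filter fun z => z.image p = q).card : ℝ) := by
      rw [card_biUnion hdisj]; push_cast; rfl
    _ ≤ Q.card := by
      exact_mod_cast card_le_card (biUnion_subset.2 fun q _ => filter_subset _ _)

/-- Adding the vertices of `W \ U` creates at most `s` supported pairs per vertex. -/
theorem suppPairs_le_suppPairs_add (U W : Finset (Fin s)) :
    suppPairs F W ≤ suppPairs F U + (W \ U).card * s := by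
  unfold suppPairs
  have hsub : ((W.powersetCard 2).filter fun q => ∃ e ∈ F, q ⊆ e) ⊆
      ((U.powersetCard 2).filter fun q => ∃ e ∈ F, q ⊆ e) ∪
        ((W \ U) ×ˢ (univ : Finset (Fin s))).image fun x => {x.1, x.2} := by
    intro q hq
    obtain ⟨hqW, hqF⟩ := mem_filter.1 hq
    obtain ⟨hqW, hq2⟩ := mem_powersetCard.1 hqW
    by_cases hqU : q ⊆ U
    · exact mem_union_left _ (mem_filter.2 ⟨mem_powersetCard.2 ⟨hqU, hq2⟩, hqF⟩)
    · obtain ⟨x, hxq, hxU⟩ := not_subset.1 hqU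
      obtain ⟨y, hy⟩ := card_eq_one.1
        (show (q.erase x).card = 1 by rw [card_erase_of_mem hxq, hq2])
      refine mem_union_right _ (mem_image.2 ⟨(x, y), ?_, ?_⟩)
      · simp [hqW hxq, hxU]
      · rw [← insert_erase hxq, hy]
  calc _ ≤ _ := card_le_card hsub
    _ ≤ _ := card_union_le _ _
    _ ≤ _ := by
      gcongr
      refine card_image_le.trans ?_
      simp

/-- If all sets of at least `s / t` vertices contain at least `μ * s ^ 2` supported pairs, then
a set with `s - t * |U| ≤ η * s` still contains at least `(μ - η) * s ^ 2` of them. -/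
theorem sub_mul_sq_le_suppPairs {t : ℕ} (ht : 1 ≤ t) {μ η : ℝ} (hη : 0 ≤ η)
    (hF : ∀ A : Finset (Fin s), (s : ℝ) / t ≤ A.card → μ * (s : ℝ) ^ 2 ≤ suppPairs F A)
    {U : Finset (Fin s)} (hU : (s : ℝ) - t * U.card ≤ η * s) :
    (μ - η) * (s : ℝ) ^ 2 ≤ suppPairs F U := by
  have ht0 : (0 : ℝ) < t := by exact_mod_cast ht
  have hUs : U.card ≤ s := by simpa using card_le_univ U
  obtain ⟨W, hUW, -, hW⟩ := exists_subsuperset_card_eq (subset_univ U)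
    (le_min (Nat.le_add_right U.card (s - t * U.card)) hUs) (by simp)
  have hWt : s ≤ W.card * t := by
    rw [hW]
    rcases min_cases (U.card + (s - t * U.card)) s with ⟨h, -⟩ | ⟨h, -⟩ <;> rw [h]
    · have h1 : s - t * U.card ≤ (s - t * U.card) * t := Nat.le_mul_of_pos_right _ ht
      have h2 : U.card * t = t * U.card := mul_comm _ _
      rw [add_mul]
      omega
    · exact Nat.le_mul_of_pos_right _ ht
  have hdiff : (W \ U).card ≤ s - t * U.card := by
    rw [card_sdiff_of_subset hUW, hW]
    omega
  have hdiff' : ((W \ U).card : ℝ) ≤ η * s := by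
    rcases le_total s (t * U.card) with h | h
    · rw [Nat.sub_eq_zero_of_le h, Nat.le_zero] at hdiff
      rw [hdiff, Nat.cast_zero]
      positivity
    · calc ((W \ U).card : ℝ) ≤ ((s - t * U.card : ℕ) : ℝ) := by exact_mod_cast hdiff
        _ ≤ η * s := by push_cast [Nat.cast_sub h]; exact hU
  have h1 := hF W (by rw [div_le_iff₀ ht0]; exact_mod_cast hWt)
  have h2 : (suppPairs F W : ℝ) ≤ suppPairs F U + (W \ U).card * s := by
    exact_mod_cast suppPairs_le_suppPairs_add U W
  nlinarith [mul_le_mul_of_nonneg_right hdiff' (Nat.cast_nonneg (α := ℝ) s)]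

end BlowUp

/-- A `(γ,m)`-regular blow-up of a non-extremal hypergraph is non-extremal
(with slightly weaker constants). -/
theorem blowup_preserves_nonextremality
    (k l t : ℕ) (hk : 3 ≤ k) (hl : 1 ≤ l) (hlk : l ≤ k - 1)
    (ht : t = k / (k - l) * (k - l)) :
    ∃ μ₀ : ℝ, 0 < μ₀ ∧ ∀ μ : ℝ, 0 < μ → μ ≤ μ₀ →
    ∃ μ'₀ : ℝ, 0 < μ'₀ ∧ ∀ μ' : ℝ, 0 < μ' → μ' ≤ μ'₀ →
    ∃ ε₀ : ℝ, 0 < ε₀ ∧ ∀ ε : ℝ, 0 < ε → ε ≤ ε₀ →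
    ∃ γ₀ : ℝ, 0 < γ₀ ∧ ∀ γ : ℝ, 0 ≤ γ → γ ≤ γ₀ →
    ∀ m s : ℕ, 1 ≤ m → 1 ≤ s →
    ∀ F : Finset (Finset (Fin s)),
      (∀ e ∈ F, e.card = k) →
      (∀ v : Fin s, ∃ e ∈ F, v ∈ e) →
      (∀ S : Finset (Fin s), S.card = k - 1 → (∃ e ∈ F, S ⊆ e) →
        (1 - 1 / (t : ℝ) - ε) * (s : ℝ) ≤ ((F.filter fun e => S ⊆ e).card : ℝ)) →
      (∀ A : Finset (Fin s), (s : ℝ) / (t : ℝ) ≤ (A.card : ℝ) →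
        μ * (s : ℝ) ^ 2 ≤ (suppPairs F A : ℝ)) →
      ∀ N : ℕ, ∀ B : Fin s → Finset (Fin N),
        (∀ u v : Fin s, u ≠ v → Disjoint (B u) (B v)) →
        Finset.univ.biUnion B = (Finset.univ : Finset (Fin N)) →
        (∀ v : Fin s, (1 - γ) * (m : ℝ) ≤ ((B v).card : ℝ) ∧
          ((B v).card : ℝ) ≤ (1 + γ) * (m : ℝ)) →
        (∀ w : Fin N, ∃ e ∈ blowUpEdges F B, w ∈ e) ∧
        (∀ S : Finset (Fin N), S.card = k - 1 → (∃ e ∈ blowUpEdges F B, S ⊆ e) →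
          (1 - 1 / (t : ℝ) - 2 * ε) * (N : ℝ) ≤
            (((blowUpEdges F B).filter fun e => S ⊆ e).card : ℝ)) ∧
        (∀ A : Finset (Fin N), (N : ℝ) / (t : ℝ) ≤ (A.card : ℝ) →
          μ' * (N : ℝ) ^ 2 ≤ (suppPairs (blowUpEdges F B) A : ℝ)) := by
  have hkl : 1 ≤ k - l := by omega
  have hq : 1 ≤ k / (k - l) := (Nat.one_le_div_iff (by omega)).2 (by omega)
  have ht1 : 1 ≤ t := ht ▸ Nat.mul_pos hq hkl
  have ht2 : 2 ≤ t := by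
    rcases hkl.eq_or_lt with h | h
    · rw [ht, ← h]
      simp only [Nat.div_one]
      omega
    · rw [ht]
      nlinarith
  have htR : (2 : ℝ) ≤ t := by exact_mod_cast ht2
  have ht0 : (0 : ℝ) < t := by linarith
  have htinv : 1 / (t : ℝ) ≤ 1 / 2 := one_div_le_one_div_of_le (by norm_num) htR
  have htinv0 : 0 < 1 / (t : ℝ) := by positivity
  refine ⟨1, one_pos, fun μ hμ _ => ⟨(μ / (4 * t)) ^ 2 * μ / 8, by positivity,
    fun μ' _ hμ'le => ⟨1 / 4, by norm_num, fun ε hε hεle =>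
      ⟨min (1 / 2) (min (ε / 2) (μ / (8 * t))), by positivity, ?_⟩⟩⟩⟩
  intro γ hγ hγle m s hm hs F hcard hiso hdeg hsupp N B hdisj hunion hB
  obtain ⟨hγ1, hγle⟩ := le_min_iff.1 hγle
  obtain ⟨hγ2, hγ3⟩ := le_min_iff.1 hγle
  rw [le_div_iff₀ (by positivity)] at hγ3
  have hm0 : (0 : ℝ) < m := by exact_mod_cast hm
  have hs0 : (0 : ℝ) < s := by exact_mod_cast hs
  have hpart : ∀ w, ∃ v, w ∈ B v := fun w => by
    have h : w ∈ univ.biUnion B := hunion.symm ▸ mem_univ w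
    simpa using h
  choose p hpB using hpart
  have hp : ∀ w v, w ∈ B v ↔ p w = v := by
    refine fun w v => ⟨fun h => ?_, fun h => h ▸ hpB w⟩
    by_contra hne
    exact disjoint_left.1 (hdisj _ _ hne) (hpB w) h
  have hsurj : Function.Surjective p := by
    intro v
    have hpos : (0 : ℝ) < (B v).card := lt_of_lt_of_le (by nlinarith) (hB v).1
    obtain ⟨w, hw⟩ := card_pos.1 (by exact_mod_cast hpos)
    exact ⟨w, (hp w v).1 hw⟩
  have hN : (N : ℝ) = ∑ v, ((B v).card : ℝ) := by
    have h := congrArg Finset.card hunion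
    rw [card_biUnion fun u _ v _ h => hdisj u v h, card_univ, Fintype.card_fin] at h
    exact_mod_cast h.symm
  have hNle : (N : ℝ) ≤ s * ((1 + γ) * m) := by
    rw [hN]
    simpa using sum_le_card_nsmul univ _ _ fun v _ => (hB v).2
  have hNge : s * ((1 - γ) * m) ≤ (N : ℝ) := by
    rw [hN]
    simpa using card_nsmul_le_sum univ _ _ fun v _ => (hB v).1
  refine ⟨fun w => ?_, fun S hS hSe => ?_, fun A hA => ?_⟩
  · obtain ⟨f, hf, hwf⟩ := hiso (p w)
    obtain ⟨e, he, hwe⟩ := exists_mem_blowUpEdges_superset hp hsurj (T := {w}) (by simp) hf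
      (by simpa using hwf)
    exact ⟨e, he, hwe (mem_singleton_self w)⟩
  · obtain ⟨e, he, hSe⟩ := hSe
    obtain ⟨heF, heinj⟩ := (mem_blowUpEdges_iff hp e).1 he
    have hSinj : Set.InjOn p S := heinj.mono (by exact_mod_cast hSe)
    have hd := hdeg (S.image p) (by rw [card_image_of_injOn hSinj, hS])
      ⟨_, heF, image_subset_image hSe⟩
    calc (1 - 1 / (t : ℝ) - 2 * ε) * N
        ≤ (1 - 1 / (t : ℝ) - 2 * ε) * (s * ((1 + γ) * m)) :=
          mul_le_mul_of_nonneg_left hNle (by linarith)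
      _ = (1 - 1 / (t : ℝ) - 2 * ε) * (1 + γ) * (s * m) := by ring
      _ ≤ (1 - 1 / (t : ℝ) - ε) * (1 - γ) * (s * m) := by
          gcongr ?_ * _
          nlinarith [mul_nonneg hγ hε.le, mul_nonneg hγ htinv0.le]
      _ = (1 - 1 / (t : ℝ) - ε) * s * ((1 - γ) * m) := by ring
      _ ≤ _ * ((1 - γ) * m) := mul_le_mul_of_nonneg_right hd (by nlinarith)
      _ ≤ _ := mul_degree_image_le_degree_blowUpEdges hp hcard (fun v => (hB v).1) hSinj
          (by omega)
  · set δ : ℝ := μ / (4 * t) with hδ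
    have hδ0 : 0 < δ := by positivity
    have hδt : t * δ = μ / 4 := by rw [hδ]; field_simp
    set U : Finset (Fin s) := univ.filter fun v => δ * m ≤ (A ∩ B v).card with hUdef
    have hAsum : (A.card : ℝ) = ∑ v, ((A ∩ B v).card : ℝ) := by
      have h : A = univ.biUnion fun v => A ∩ B v := by
        rw [← inter_biUnion, hunion, inter_univ]
      conv_lhs => rw [h]
      rw [card_biUnion fun u _ v _ h =>
        (hdisj u v h).mono inter_subset_right inter_subset_right]
      push_cast
      rfl
    have hAle : (A.card : ℝ) ≤ U.card * ((1 + γ) * m) + s * (δ * m) := by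
      rw [hAsum]
      calc ∑ v, ((A ∩ B v).card : ℝ)
          ≤ ∑ v, ((if v ∈ U then (1 + γ) * m else 0) + δ * m) := by
            refine sum_le_sum fun v _ => ?_
            split_ifs with hv
            · have h1 : ((A ∩ B v).card : ℝ) ≤ (B v).card := by
                exact_mod_cast card_le_card inter_subset_right
              linarith [(hB v).2, mul_pos hδ0 hm0]
            · rw [zero_add]
              exact (not_le.1 fun h => hv (by simp [hUdef, h])).le
        _ = _ := by simp [sum_add_distrib]
    have hUs : (U.card : ℝ) ≤ s := by exact_mod_cast (by simpa using card_le_univ U)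
    rw [div_le_iff₀ ht0] at hA
    have hkey : (s : ℝ) * (1 - γ) ≤ (U.card * (1 + γ) + s * δ) * t := by
      refine le_of_mul_le_mul_right ?_ hm0
      calc (s : ℝ) * (1 - γ) * m = s * ((1 - γ) * m) := by ring
        _ ≤ A.card * t := hNge.trans hA
        _ ≤ (U.card * ((1 + γ) * m) + s * (δ * m)) * t :=
          mul_le_mul_of_nonneg_right hAle ht0.le
        _ = _ := by ring
    have hUη : (s : ℝ) - t * U.card ≤ μ / 2 * s := by
      have h1 : γ * t * U.card ≤ γ * t * s := by gcongr
      have h2 : γ * 1 ≤ γ * t := by gcongr; linarith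
      have h3 : (γ + γ * t) * s ≤ μ / 4 * s := by
        gcongr
        linarith
      have h4 : s * (t * δ) = s * (μ / 4) := by rw [hδt]
      linarith
    have hUpairs := sub_mul_sq_le_suppPairs ht1 (by positivity) hsupp hUη
    have hN2 : (N : ℝ) ≤ 2 * (s * m) := by
      refine hNle.trans ?_
      nlinarith [mul_pos hs0 hm0]
    calc μ' * (N : ℝ) ^ 2 ≤ δ ^ 2 * μ / 8 * (2 * (s * m)) ^ 2 := by gcongr
      _ = (μ - μ / 2) * (s : ℝ) ^ 2 * (δ * m) ^ 2 := by ring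
      _ ≤ suppPairs F U * (δ * m) ^ 2 := by gcongr
      _ ≤ _ := suppPairs_mul_sq_le_suppPairs_blowUpEdges hp hsurj (by positivity)
          fun v hv => (mem_filter.1 hv).2
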